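/- Let k be a real number and C a double-[α,θ₁,θ₂]-defined function with middle slope θ = −4α. If θ₁ ⋈ k, θ₂ ⋈ k, and θ ⋈ k, where ⋈ is one of the relations ≤, <, >, ≥ (the same one in all three hypotheses), then C′(x) ⋈ k for all x ∈ [0,1]. -/

import Mathlib

open Set

/-- The function `Elastic α d₁ d₂` on `[0,1]`. -/
noncomputable def Elastic (α d₁ d₂ : ℝ) : ℝ → ℝ := fun x =>
  if x ≤ 1/2 then α * (1 - (2*x - 1)^2 * Real.exp (-2*d₁*x))
  else α * (1 - (2*x - 1)^2 * Real.exp (-2*d₂*(1-x)))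

/-- `C : [0,1] → ℝ` is single-`[α,θ₁,θ₂]`-defined: it belongs to the `[α]`-elastic
family and its one-sided derivatives at the endpoints are `θ₁` and `θ₂`. -/
def IsSingleDefined (α θ₁ θ₂ : ℝ) (C : ℝ → ℝ) : Prop :=
  (∃ d₁ d₂ : ℝ, 0 ≤ d₁ ∧ 0 ≤ d₂ ∧ ∀ x ∈ Icc (0:ℝ) 1, C x = Elastic α d₁ d₂ x) ∧
  derivWithin C (Icc 0 1) 0 = θ₁ ∧ derivWithin C (Icc 0 1) 1 = θ₂

/-- `C : [0,1] → ℝ` is double-`[α,θ₁,θ₂]`-defined, with middle slope `θ = -4α`. -/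
def IsDoubleDefined (α θ₁ θ₂ : ℝ) (C : ℝ → ℝ) : Prop :=
  ∃ C₁ C₂ : ℝ → ℝ,
    IsSingleDefined (α/2) (θ₁/2) ((-4*α)/2) C₁ ∧
    IsSingleDefined (-α/2) ((-4*α)/2) (θ₂/2) C₂ ∧
    ∀ x ∈ Icc (0:ℝ) 1, C x = if x ≤ 1/2 then C₁ (2*x) else C₂ (2*x - 1)

/-- Two differentiable functions agreeing to first order at `c` glue to a differentiable function. -/
theorem hasDerivAt_ite_le {f g f' g' : ℝ → ℝ} {c : ℝ} (hf : ∀ x, HasDerivAt f (f' x) x)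
    (hg : ∀ x, HasDerivAt g (g' x) x) (h : f c = g c) (h' : f' c = g' c) (x : ℝ) :
    HasDerivAt (fun y => if y ≤ c then f y else g y) (if x ≤ c then f' x else g' x) x := by
  rcases lt_trichotomy x c with hx | rfl | hx
  · rw [if_pos hx.le]
    refine (hf x).congr_of_eventuallyEq ?_
    filter_upwards [Iio_mem_nhds hx] with y hy
    exact if_pos (le_of_lt hy)
  · rw [if_pos le_rfl, ← hasDerivWithinAt_univ, ← Iic_union_Ici (a := x)]
    refine HasDerivWithinAt.union ?_ ?_
    · exact (hf x).hasDerivWithinAt.congr (fun y hy => if_pos hy) (if_pos le_rfl)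
    · rw [h']
      refine (hg x).hasDerivWithinAt.congr (fun y hy => ?_) ((if_pos le_rfl).trans h)
      rcases eq_or_lt_of_le (mem_Ici.1 hy) with rfl | hlt
      · exact (if_pos le_rfl).trans h
      · exact if_neg (not_le.2 hlt)
  · rw [if_neg (not_le.2 hx)]
    refine (hg x).congr_of_eventuallyEq ?_
    filter_upwards [Ioi_mem_nhds hx] with y hy
    exact if_neg (not_le.2 hy)

/-- The derivative of `Elastic 1 d₁ d₂`. -/
noncomputable def elasticSlope (d₁ d₂ x : ℝ) : ℝ :=
  if x ≤ 1/2 then (1 - 2*x) * Real.exp (-2*d₁*x) * (4 + 2*d₁*(1 - 2*x))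
  else -((2*x - 1) * Real.exp (-2*d₂*(1-x)) * (4 + 2*d₂*(2*x - 1)))

theorem hasDerivAt_elastic (α d₁ d₂ x : ℝ) :
    HasDerivAt (Elastic α d₁ d₂) (α * elasticSlope d₁ d₂ x) x := by
  have hsq : ∀ y : ℝ, HasDerivAt (fun x : ℝ => (2*x - 1)^2) (4*(2*y - 1)) y := fun y => by
    refine ((((hasDerivAt_id y).const_mul 2).sub_const 1).pow 2).congr_deriv ?_
    simp only [id]; ring
  have key := hasDerivAt_ite_le (c := 1/2)
    (f := fun x => α * (1 - (2*x - 1)^2 * Real.exp (-2*d₁*x)))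
    (g := fun x => α * (1 - (2*x - 1)^2 * Real.exp (-2*d₂*(1-x))))
    (f' := fun x => α * ((1 - 2*x) * Real.exp (-2*d₁*x) * (4 + 2*d₁*(1 - 2*x))))
    (g' := fun x => α * -((2*x - 1) * Real.exp (-2*d₂*(1-x)) * (4 + 2*d₂*(2*x - 1))))
    (fun y => by
      refine (((hsq y).mul ((hasDerivAt_id y).const_mul (-2*d₁)).exp).const_sub 1
        |>.const_mul α).congr_deriv ?_
      simp only [id]; ring)
    (fun y => by
      refine (((hsq y).mul (((hasDerivAt_id y).const_sub 1).const_mul (-2*d₂)).exp).const_sub 1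
        |>.const_mul α).congr_deriv ?_
      simp only [id]; ring)
    (by norm_num) (by norm_num) x
  refine key.congr_deriv ?_
  unfold elasticSlope
  split_ifs <;> rfl

theorem elasticSlope_zero (d₁ d₂ : ℝ) : elasticSlope d₁ d₂ 0 = 4 + 2*d₁ := by
  norm_num [elasticSlope]

theorem elasticSlope_one (d₁ d₂ : ℝ) : elasticSlope d₁ d₂ 1 = -(4 + 2*d₂) := by
  norm_num [elasticSlope]

theorem slope_factor_mem_Icc {d t s : ℝ} (hd : 0 ≤ d) (ht : t ∈ Icc (0:ℝ) 1) (hs : 0 ≤ s) :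
    t * Real.exp (-2*d*s) * (4 + 2*d*t) ∈ Icc 0 (4 + 2*d) := by
  have he : Real.exp (-2*d*s) ≤ 1 := Real.exp_le_one_iff.2 (by nlinarith [mul_nonneg hd hs])
  have hpos := Real.exp_pos (-2*d*s)
  have hdt : 0 ≤ d*t := mul_nonneg hd ht.1
  refine ⟨by have := ht.1; positivity, ?_⟩
  calc t * Real.exp (-2*d*s) * (4 + 2*d*t) ≤ 1 * (4 + 2*d*t) := by
        gcongr
        · nlinarith
        · exact mul_le_one₀ ht.2 hpos.le he
    _ ≤ 4 + 2*d := by nlinarith [mul_le_of_le_one_right hd ht.2]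

theorem elasticSlope_mem_uIcc {d₁ d₂ x : ℝ} (h₁ : 0 ≤ d₁) (h₂ : 0 ≤ d₂) (hx : x ∈ Icc (0:ℝ) 1) :
    elasticSlope d₁ d₂ x ∈ uIcc (elasticSlope d₁ d₂ 0) (elasticSlope d₁ d₂ 1) := by
  rw [elasticSlope_zero, elasticSlope_one, uIcc_comm, uIcc_of_le (by linarith)]
  obtain ⟨hx0, hx1⟩ := hx
  unfold elasticSlope
  split_ifs with h
  · obtain ⟨ha, hb⟩ := slope_factor_mem_Icc (t := 1 - 2*x) h₁
      ⟨by linarith, by linarith⟩ hx0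
    exact ⟨by linarith, hb⟩
  · obtain ⟨ha, hb⟩ := slope_factor_mem_Icc (t := 2*x - 1) h₂
      ⟨by linarith, by linarith⟩ (sub_nonneg.2 hx1)
    exact ⟨by linarith, by linarith⟩

/-- A single-defined function is the restriction of a differentiable function whose slopes
on `[0,1]` lie between the endpoint slopes. -/
theorem IsSingleDefined.exists_hasDerivAt {α θ₁ θ₂ : ℝ} {C : ℝ → ℝ}
    (h : IsSingleDefined α θ₁ θ₂ C) :
    ∃ E E' : ℝ → ℝ, (∀ x ∈ Icc (0:ℝ) 1, C x = E x) ∧ (∀ x, HasDerivAt E (E' x) x) ∧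
      E 0 = 0 ∧ E 1 = 0 ∧ E' 0 = θ₁ ∧ E' 1 = θ₂ ∧ ∀ x ∈ Icc (0:ℝ) 1, E' x ∈ uIcc θ₁ θ₂ := by
  obtain ⟨⟨d₁, d₂, h₁, h₂, hC⟩, hθ₁, hθ₂⟩ := h
  have hd : ∀ x ∈ Icc (0:ℝ) 1, derivWithin C (Icc 0 1) x = α * elasticSlope d₁ d₂ x :=
    fun x hx => ((hasDerivAt_elastic α d₁ d₂ x).hasDerivWithinAt.congr hC (hC x hx)).derivWithin
      (uniqueDiffOn_Icc_zero_one x hx)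
  rw [hd 0 (by simp)] at hθ₁
  rw [hd 1 (by simp)] at hθ₂
  refine ⟨Elastic α d₁ d₂, fun x => α * elasticSlope d₁ d₂ x, hC, hasDerivAt_elastic α d₁ d₂,
    by norm_num [Elastic], by norm_num [Elastic], hθ₁, hθ₂, fun x hx => ?_⟩
  rw [← hθ₁, ← hθ₂, ← image_const_mul_uIcc]
  exact mem_image_of_mem _ (elasticSlope_mem_uIcc h₁ h₂ hx)

theorem IsDoubleDefined.derivWithin_mem {α θ₁ θ₂ : ℝ} {C : ℝ → ℝ}
    (hC : IsDoubleDefined α θ₁ θ₂ C) {x : ℝ} (hx : x ∈ Icc (0:ℝ) 1) :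
    derivWithin C (Icc 0 1) x ∈ uIcc θ₁ (-4*α) ∪ uIcc (-4*α) θ₂ := by
  obtain ⟨C₁, C₂, hC₁, hC₂, hC⟩ := hC
  obtain ⟨E, E', hCE, hE, -, hE1, -, hE'1, hEb⟩ := hC₁.exists_hasDerivAt
  obtain ⟨F, F', hCF, hF, hF0, -, hF'0, -, hFb⟩ := hC₂.exists_hasDerivAt
  have two_mul_mem : ∀ {v a b : ℝ}, v ∈ uIcc (a/2) (b/2) → v*2 ∈ uIcc a b := fun {v a b} hv => by
    have := mem_image_of_mem (fun y : ℝ => y*2) hv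
    rwa [image_mul_const_uIcc, div_mul_cancel₀ _ two_ne_zero,
      div_mul_cancel₀ _ two_ne_zero] at this
  have key := hasDerivAt_ite_le (c := 1/2) (f := fun y => E (2*y)) (g := fun y => F (2*y - 1))
    (f' := fun y => E' (2*y) * 2) (g' := fun y => F' (2*y - 1) * 2)
    (fun y => (hE (2*y)).comp y (by simpa using (hasDerivAt_id y).const_mul 2))
    (fun y => (hF (2*y - 1)).comp y
      (by simpa using ((hasDerivAt_id y).const_mul 2).sub_const 1))
    (by norm_num [hE1, hF0]) (by norm_num [hE'1, hF'0]) x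
  have heq : ∀ y ∈ Icc (0:ℝ) 1, C y = if y ≤ 1/2 then E (2*y) else F (2*y - 1) := by
    intro y hy
    obtain ⟨hy0, hy1⟩ := hy
    rw [hC y ⟨hy0, hy1⟩]
    split_ifs with h
    · exact hCE _ ⟨by linarith, by linarith⟩
    · exact hCF _ ⟨by linarith, by linarith⟩
  rw [(key.hasDerivWithinAt.congr heq (heq x hx)).derivWithin (uniqueDiffOn_Icc_zero_one x hx)]
  obtain ⟨hx0, hx1⟩ := hx
  split_ifs with h
  · exact Or.inl (two_mul_mem (hEb _ ⟨by linarith, by linarith⟩))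
  · exact Or.inr (two_mul_mem (hFb _ ⟨by linarith, by linarith⟩))

theorem doubleDefined_deriv_bound (α θ₁ θ₂ k : ℝ) (C : ℝ → ℝ)
    (hC : IsDoubleDefined α θ₁ θ₂ C) :
    (θ₁ ≤ k → θ₂ ≤ k → -4*α ≤ k → ∀ x ∈ Icc (0:ℝ) 1, derivWithin C (Icc 0 1) x ≤ k) ∧
    (θ₁ < k → θ₂ < k → -4*α < k → ∀ x ∈ Icc (0:ℝ) 1, derivWithin C (Icc 0 1) x < k) ∧
    (k < θ₁ → k < θ₂ → k < -4*α → ∀ x ∈ Icc (0:ℝ) 1, k < derivWithin C (Icc 0 1) x) ∧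
    (k ≤ θ₁ → k ≤ θ₂ → k ≤ -4*α → ∀ x ∈ Icc (0:ℝ) 1, k ≤ derivWithin C (Icc 0 1) x) := by
  refine ⟨fun h₁ h₂ h x hx => ?_, fun h₁ h₂ h x hx => ?_, fun h₁ h₂ h x hx => ?_,
    fun h₁ h₂ h x hx => ?_⟩ <;>
  rcases hC.derivWithin_mem hx with hv | hv <;>
  rcases mem_uIcc.1 hv with ⟨ha, hb⟩ | ⟨ha, hb⟩ <;>
  linarith
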